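/- arXiv:2303.17521 — 7 statements merged into one kernel-verified Lean document; each statement's English description precedes it below -/
import Mathlib

section
/- Let α > 0 and a ∈ [0,1]. For every x ∈ (0,1) with x ≠ T_α(a), the set {y ∈ [0,a] : T_α(y) = x} is finite and its cardinality equals ⌊αa⌋ + 1 if x < T_α(a), and ⌊αa⌋ if x > T_α(a). Consequently, for Lebesgue-almost every x ∈ [0,1], (L_α 𝟙_{[0,a]})(x) = ⌊αa⌋/α + (1/α)·𝟙_{[0,T_α(a)]}(x). -/
open MeasureTheory

/-- The beta-transformation `T_α(x) = αx - ⌊αx⌋`. -/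
noncomputable def betaT (α x : ℝ) : ℝ := Int.fract (α * x)

lemma betaT_fibre_eq_image {α a x : ℝ} (hα : 0 < α) (ha : 0 ≤ a)
    (hx : x ∈ Set.Ico (0 : ℝ) 1) (hxa : x ≠ betaT α a) :
    {y : ℝ | y ∈ Set.Icc 0 a ∧ betaT α y = x} =
      (fun k : ℕ => (k + x) / α) ''
        (Finset.range (if x < betaT α a then ⌊α * a⌋₊ + 1 else ⌊α * a⌋₊) : Set ℕ) := by
  have hdecomp : α * a = ⌊α * a⌋₊ + betaT α a := by
    rw [natCast_floor_eq_intCast_floor (by positivity), betaT, Int.floor_add_fract]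
  have hT0 : 0 ≤ betaT α a := Int.fract_nonneg _
  have hT1 : betaT α a < 1 := Int.fract_lt_one _
  obtain ⟨hx0, hx1⟩ := hx
  have key (k : ℕ) : (k : ℝ) + x ≤ α * a ↔
      k < (if x < betaT α a then ⌊α * a⌋₊ + 1 else ⌊α * a⌋₊) := by
    generalize betaT α a = T at *
    generalize ⌊α * a⌋₊ = n at *
    rw [hdecomp]
    split_ifs with h
    · rw [Nat.lt_succ_iff]
      constructor
      · intro hk
        have : (k : ℝ) < (n + 1 : ℕ) := by push_cast; linarith
        exact Nat.lt_succ_iff.mp (by exact_mod_cast this)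
      · intro hk
        have : (k : ℝ) ≤ n := by exact_mod_cast hk
        linarith
    · have hlt : T < x := lt_of_le_of_ne (not_lt.mp h) hxa.symm
      constructor
      · intro hk
        have : (k : ℝ) < n := by linarith
        exact_mod_cast this
      · intro hk
        have : ((k + 1 : ℕ) : ℝ) ≤ n := by exact_mod_cast hk
        push_cast at this
        linarith
  ext y
  simp only [Set.mem_ofPred_eq, Set.mem_Icc, Set.mem_image, Finset.mem_coe, Finset.mem_range]
  constructor
  · rintro ⟨⟨hy0, hya⟩, hy⟩
    have hfloor : (⌊α * y⌋₊ : ℝ) + x = α * y := by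
      rw [natCast_floor_eq_intCast_floor (by positivity), ← hy, betaT, Int.floor_add_fract]
    refine ⟨⌊α * y⌋₊, (key _).mp ?_, ?_⟩
    · rw [hfloor]
      gcongr
    · rw [hfloor]
      field_simp
  · rintro ⟨k, hk, rfl⟩
    refine ⟨⟨by positivity, ?_⟩, ?_⟩
    · rw [div_le_iff₀ hα, mul_comm a]
      exact (key k).mpr hk
    · rw [betaT, mul_div_cancel₀ _ hα.ne', Int.fract_natCast_add]
      exact Int.fract_eq_self.mpr ⟨hx0, hx1⟩

lemma betaT_fibre_finite {α a x : ℝ} (hα : 0 < α) (ha : 0 ≤ a)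
    (hx : x ∈ Set.Ico (0 : ℝ) 1) (hxa : x ≠ betaT α a) :
    {y : ℝ | y ∈ Set.Icc 0 a ∧ betaT α y = x}.Finite := by
  rw [betaT_fibre_eq_image hα ha hx hxa]
  exact (Finset.finite_toSet _).image _

lemma betaT_fibre_ncard {α a x : ℝ} (hα : 0 < α) (ha : 0 ≤ a)
    (hx : x ∈ Set.Ico (0 : ℝ) 1) (hxa : x ≠ betaT α a) :
    ({y : ℝ | y ∈ Set.Icc 0 a ∧ betaT α y = x}.ncard : ℤ) =
      if x < betaT α a then ⌊α * a⌋ + 1 else ⌊α * a⌋ := by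
  have hinj : Function.Injective (fun k : ℕ => ((k : ℝ) + x) / α) := fun k l h => by
    simpa [div_left_inj' hα.ne'] using h
  rw [betaT_fibre_eq_image hα ha hx hxa, Set.ncard_image_of_injective _ hinj,
    Set.ncard_coe_finset, Finset.card_range, ← Int.natCast_floor_eq_floor (by positivity)]
  split_ifs <;> simp

lemma finsum_mem_indicator_one_eq_ncard {β : Type*} (s t : Set β) (h : (s ∩ t).Finite) :
    ∑ᶠ y ∈ s, t.indicator (fun _ => (1 : ℝ)) y = (s ∩ t).ncard := by
  have heq : ∑ᶠ y ∈ s, t.indicator (fun _ => (1 : ℝ)) y = ∑ᶠ y ∈ s ∩ t, (1 : ℝ) := by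
    rw [finsum_mem_def, finsum_mem_def, Set.indicator_indicator]
  rw [heq, finsum_mem_eq_finite_toFinset_sum _ h, Set.ncard_eq_toFinset_card _ h]
  simp

/-- For `α > 0` and `a ∈ [0,1]`: for every `x ∈ (0,1)` with `x ≠ T_α(a)` the
fibre `{y ∈ [0,a] : T_α y = x}` is finite with cardinality `⌊αa⌋ + 1` if `x < T_α(a)` and
`⌊αa⌋` if `x > T_α(a)`; consequently, for Lebesgue-a.e. `x ∈ [0,1]`,
`(L_α 𝟙_{[0,a]})(x) = ⌊αa⌋/α + (1/α) 𝟙_{[0,T_α(a)]}(x)`. -/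
theorem stmt_2 (α : ℝ) (hα : 0 < α) (a : ℝ) (ha : a ∈ Set.Icc (0:ℝ) 1) :
    (∀ x ∈ Set.Ioo (0:ℝ) 1, x ≠ betaT α a →
      {y : ℝ | y ∈ Set.Icc 0 a ∧ betaT α y = x}.Finite ∧
      (Nat.card {y : ℝ // y ∈ Set.Icc 0 a ∧ betaT α y = x} : ℤ) =
        (if x < betaT α a then ⌊α * a⌋ + 1 else ⌊α * a⌋)) ∧
    (∀ᵐ x ∂(volume.restrict (Set.Icc (0:ℝ) 1)),
      (1 / α) * ∑ᶠ y ∈ {y : ℝ | y ∈ Set.Icc (0:ℝ) 1 ∧ betaT α y = x},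
          Set.indicator (Set.Icc (0:ℝ) a) (fun _ => (1:ℝ)) y
        = (⌊α * a⌋ : ℝ) / α
            + (1 / α) * Set.indicator (Set.Icc (0:ℝ) (betaT α a)) (fun _ => (1:ℝ)) x) := by
  have hIco {x : ℝ} (hx : x ∈ Set.Ioo (0 : ℝ) 1) : x ∈ Set.Ico (0 : ℝ) 1 := ⟨hx.1.le, hx.2⟩
  refine ⟨fun x hx hxa => ⟨betaT_fibre_finite hα ha.1 (hIco hx) hxa,
    betaT_fibre_ncard hα ha.1 (hIco hx) hxa⟩, ?_⟩
  rw [← restrict_Ioo_eq_restrict_Icc]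
  filter_upwards [ae_restrict_mem measurableSet_Ioo,
    ae_restrict_of_ae (Measure.ae_ne volume (betaT α a))] with x hx hxa
  have hset : {y : ℝ | y ∈ Set.Icc (0 : ℝ) 1 ∧ betaT α y = x} ∩ Set.Icc 0 a =
      {y : ℝ | y ∈ Set.Icc 0 a ∧ betaT α y = x} := by
    ext y
    simp only [Set.mem_inter_iff, Set.mem_ofPred_eq, Set.mem_Icc]
    exact ⟨fun h => ⟨h.2, h.1.2⟩, fun h => ⟨⟨⟨h.1.1, h.1.2.trans ha.2⟩, h.2⟩, h.1⟩⟩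
  have hcard : ({y : ℝ | y ∈ Set.Icc 0 a ∧ betaT α y = x}.ncard : ℝ) =
      ((if x < betaT α a then ⌊α * a⌋ + 1 else ⌊α * a⌋ : ℤ) : ℝ) := by
    exact_mod_cast betaT_fibre_ncard hα ha.1 (hIco hx) hxa
  have hsum := finsum_mem_indicator_one_eq_ncard _ _
    (hset ▸ betaT_fibre_finite hα ha.1 (hIco hx) hxa)
  rw [hset, hcard] at hsum
  simp only [Set.mem_ofPred_eq] at hsum
  rw [hsum]
  split_ifs with h
  · rw [Set.indicator_of_mem (Set.mem_Icc.mpr ⟨hx.1.le, h.le⟩)]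
    push_cast
    ring
  · rw [Set.indicator_of_notMem fun hm => h (lt_of_le_of_ne hm.2 hxa)]
    ring
end

section
/- In the i.i.d. setting, assume r := ∫_{Ω̂} (1/β̂(a)) dP̂(a) < 1. Then for every x ∈ [0,1] the series defining φ(x) converges, φ is non-increasing on [0,1], and ‖φ‖_{L¹([0,1])} + Var(φ) ≤ 2/(1 − r), where Var(φ) denotes the total variation of φ on [0,1]; in particular φ has bounded variation. -/
open MeasureTheory

/-- Apply beta-transformations with slopes `bs = [β(ω₁), …, β(ω_n)]` in order:
`τ_{ω₁…ω_n} = T_{β(ω_n)} ∘ ⋯ ∘ T_{β(ω₁)}`, where `T_α y = Int.fract (α * y)`. -/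
noncomputable def tauList (bs : List ℝ) (x : ℝ) : ℝ :=
  bs.foldl (fun y b => Int.fract (b * y)) x

/-- The `n`-th term (for word length `n + 1 ≥ 1`) of the series defining `φ`:
`∫_{Ω̂^{n+1}} (∏ᵢ β̂(ωᵢ))⁻¹ 𝟙_{[0, τ_{ω₁…ω_{n+1}}(1)]}(x) dP̂^{n+1}`. -/
noncomputable def phiTerm {Ω : Type*} [MeasurableSpace Ω] (P : Measure Ω) (β : Ω → ℝ)
    (n : ℕ) (x : ℝ) : ℝ :=
  ∫ w : Fin (n + 1) → Ω,
    (∏ i, β (w i))⁻¹ *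
      Set.indicator (Set.Icc (0:ℝ) (tauList (List.ofFn fun i => β (w i)) 1)) (fun _ => (1:ℝ)) x
    ∂(Measure.pi fun _ => P)

/-- The (unnormalized) stationary density
`φ(x) = 1 + ∑_{n=1}^∞ ∫_{Ω̂^n} (∏ᵢ β̂(ωᵢ))⁻¹ 𝟙_{[0, τ_{ω₁…ω_n}(1)]}(x) dP̂^n`. -/
noncomputable def phiFun {Ω : Type*} [MeasurableSpace Ω] (P : Measure Ω) (β : Ω → ℝ)
    (x : ℝ) : ℝ :=
  1 + ∑' n : ℕ, phiTerm P β n x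

theorem measurable_tauList_ofFn (n : ℕ) :
    Measurable fun p : (Fin n → ℝ) × ℝ => tauList (List.ofFn p.1) p.2 := by
  induction n with
  | zero => simpa [tauList] using measurable_snd
  | succ n ih =>
    have h : Measurable fun p : (Fin (n + 1) → ℝ) × ℝ =>
        ((fun i => p.1 i.succ : Fin n → ℝ), Int.fract (p.1 0 * p.2)) := by
      fun_prop
    simpa [tauList, List.ofFn_succ, Function.comp_def] using ih.comp h

theorem indicator_Icc_le_one (t x : ℝ) :
    Set.indicator (Set.Icc (0 : ℝ) t) (fun _ => (1 : ℝ)) x ≤ 1 :=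
  Set.indicator_le_self' (fun _ _ => zero_le_one) x

theorem indicator_Icc_nonneg (t x : ℝ) :
    0 ≤ Set.indicator (Set.Icc (0 : ℝ) t) (fun _ => (1 : ℝ)) x :=
  Set.indicator_nonneg (fun _ _ => zero_le_one) x

theorem indicator_Icc_antitone {t x y : ℝ} (hx : 0 ≤ x) (hxy : x ≤ y) :
    Set.indicator (Set.Icc (0 : ℝ) t) (fun _ => (1 : ℝ)) y ≤
      Set.indicator (Set.Icc (0 : ℝ) t) (fun _ => (1 : ℝ)) x := by
  by_cases hy : y ∈ Set.Icc (0 : ℝ) t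
  · rw [Set.indicator_of_mem hy, Set.indicator_of_mem (Set.mem_Icc.2 ⟨hx, hxy.trans hy.2⟩)]
  · rw [Set.indicator_of_notMem hy]
    exact indicator_Icc_nonneg t x

theorem AntitoneOn.eVariationOn_inter_Icc {α : Type*} [LinearOrder α] {f : α → ℝ}
    {s : Set α} (hf : AntitoneOn f s) {a b : α} (ha : a ∈ s) (hb : b ∈ s) :
    eVariationOn f (s ∩ Set.Icc a b) = ENNReal.ofReal (f a - f b) := by
  have hneg : eVariationOn (fun x => -f x) (s ∩ Set.Icc a b) =
      eVariationOn f (s ∩ Set.Icc a b) := by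
    simp only [eVariationOn, edist_neg_neg]
  simpa [hneg, neg_add_eq_sub] using hf.neg.eVariationOn_eq ha hb

section PhiTerm

variable {Ω : Type*} {β : Ω → ℝ}

theorem prod_inv_nonneg (hβpos : ∀ a, 0 < β a) {n : ℕ} (w : Fin n → Ω) :
    0 ≤ (∏ i, β (w i))⁻¹ :=
  inv_nonneg.2 (Finset.prod_nonneg fun i _ => (hβpos (w i)).le)

variable [MeasurableSpace Ω] {P : Measure Ω}

theorem phiTerm_nonneg (hβpos : ∀ a, 0 < β a) (n : ℕ) (x : ℝ) : 0 ≤ phiTerm P β n x :=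
  integral_nonneg fun w => mul_nonneg (prod_inv_nonneg hβpos w) (indicator_Icc_nonneg _ _)

variable [IsProbabilityMeasure P]

theorem integrable_prod_inv (hint : Integrable (fun a => (β a)⁻¹) P) (n : ℕ) :
    Integrable (fun w : Fin n → Ω => (∏ i, β (w i))⁻¹) (Measure.pi fun _ => P) := by
  simp_rw [← Finset.prod_inv_distrib]
  exact Integrable.fintype_prod fun _ => hint

theorem integral_prod_inv (n : ℕ) :
    ∫ w : Fin n → Ω, (∏ i, β (w i))⁻¹ ∂(Measure.pi fun _ => P) = (∫ a, (β a)⁻¹ ∂P) ^ n := by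
  simp_rw [← Finset.prod_inv_distrib]
  rw [integral_fintype_prod_eq_pow (fun a => (β a)⁻¹), Fintype.card_fin]

theorem integrable_phiTerm_integrand (hβmeas : Measurable β)
    (hint : Integrable (fun a => (β a)⁻¹) P) (n : ℕ) (x : ℝ) :
    Integrable (fun w : Fin n → Ω => (∏ i, β (w i))⁻¹ *
      Set.indicator (Set.Icc (0 : ℝ) (tauList (List.ofFn fun i => β (w i)) 1))
        (fun _ => (1 : ℝ)) x) (Measure.pi fun _ => P) := by
  have hτ : Measurable fun w : Fin n → Ω => tauList (List.ofFn fun i => β (w i)) 1 := by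
    have h : Measurable fun w : Fin n → Ω => ((fun i => β (w i) : Fin n → ℝ), (1 : ℝ)) := by
      fun_prop
    exact (measurable_tauList_ofFn n).comp h
  have hind : Measurable fun w : Fin n → Ω =>
      Set.indicator (Set.Icc (0 : ℝ) (tauList (List.ofFn fun i => β (w i)) 1))
        (fun _ => (1 : ℝ)) x := by
    classical
    simp only [Set.indicator_apply, Set.mem_Icc]
    exact Measurable.ite ((MeasurableSet.const _).inter (measurableSet_le measurable_const hτ))
      measurable_const measurable_const
  refine (integrable_prod_inv hint n).mul_bdd (c := 1) hind.aestronglyMeasurable ?_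
  refine Filter.Eventually.of_forall fun w => ?_
  rw [Real.norm_of_nonneg (indicator_Icc_nonneg _ _)]
  exact indicator_Icc_le_one _ _

theorem phiTerm_le_pow (hβmeas : Measurable β) (hβpos : ∀ a, 0 < β a)
    (hint : Integrable (fun a => (β a)⁻¹) P) (n : ℕ) (x : ℝ) :
    phiTerm P β n x ≤ (∫ a, (β a)⁻¹ ∂P) ^ (n + 1) := by
  rw [← integral_prod_inv]
  exact integral_mono (integrable_phiTerm_integrand hβmeas hint (n + 1) x)
    (integrable_prod_inv hint (n + 1)) fun w =>
      mul_le_of_le_one_right (prod_inv_nonneg hβpos w) (indicator_Icc_le_one _ _)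

theorem phiTerm_antitone (hβmeas : Measurable β) (hβpos : ∀ a, 0 < β a)
    (hint : Integrable (fun a => (β a)⁻¹) P) (n : ℕ) {x y : ℝ} (hx : 0 ≤ x) (hxy : x ≤ y) :
    phiTerm P β n y ≤ phiTerm P β n x :=
  integral_mono (integrable_phiTerm_integrand hβmeas hint (n + 1) y)
    (integrable_phiTerm_integrand hβmeas hint (n + 1) x) fun w =>
      mul_le_mul_of_nonneg_left (indicator_Icc_antitone hx hxy) (prod_inv_nonneg hβpos w)

end PhiTerm

/-- In the i.i.d. setting with `r = ∫ 1/β̂ dP̂ < 1`, the series defining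
`φ(x)` converges for every `x`, `φ` is non-increasing on `[0,1]`, and
`‖φ‖_{L¹([0,1])} + Var(φ) ≤ 2/(1-r)`; in particular `φ` has bounded variation. -/
theorem stmt_3 {Ω : Type*} [MeasurableSpace Ω] (P : Measure Ω) [IsProbabilityMeasure P]
    (β : Ω → ℝ) (hβmeas : Measurable β) (hβpos : ∀ a, 0 < β a)
    (hint : Integrable (fun a => (β a)⁻¹) P)
    (r : ℝ) (hr : r = ∫ a, (β a)⁻¹ ∂P) (hr1 : r < 1) :
    (∀ x : ℝ, Summable fun n : ℕ => phiTerm P β n x) ∧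
    (∀ x ∈ Set.Icc (0:ℝ) 1, ∀ y ∈ Set.Icc (0:ℝ) 1, x ≤ y → phiFun P β y ≤ phiFun P β x) ∧
    eVariationOn (phiFun P β) (Set.Icc 0 1) ≠ ⊤ ∧
    (∫ x in Set.Icc (0:ℝ) 1, |phiFun P β x|)
        + (eVariationOn (phiFun P β) (Set.Icc 0 1)).toReal ≤ 2 / (1 - r) := by
  have hr0 : 0 ≤ r := hr ▸ integral_nonneg fun a => (inv_pos.2 (hβpos a)).le
  have hgeom : HasSum (fun n : ℕ => r ^ (n + 1)) (r * (1 - r)⁻¹) := by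
    simpa [pow_succ'] using (hasSum_geometric_of_lt_one hr0 hr1).mul_left r
  have hle (n : ℕ) (x : ℝ) : phiTerm P β n x ≤ r ^ (n + 1) :=
    hr ▸ phiTerm_le_pow hβmeas hβpos hint n x
  have hsum (x : ℝ) : Summable fun n : ℕ => phiTerm P β n x :=
    hgeom.summable.of_nonneg_of_le (fun n => phiTerm_nonneg hβpos n x) fun n => hle n x
  have hanti : AntitoneOn (phiFun P β) (Set.Icc 0 1) := fun x hx y _ hxy =>
    add_le_add_right ((hsum y).tsum_le_tsum
      (fun n => phiTerm_antitone hβmeas hβpos hint n hx.1 hxy) (hsum x)) 1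
  have hnonneg (x : ℝ) : 0 ≤ phiFun P β x :=
    add_nonneg zero_le_one (tsum_nonneg fun n => phiTerm_nonneg hβpos n x)
  have hbound (x : ℝ) : phiFun P β x ≤ 1 / (1 - r) := by
    have h : ∑' n : ℕ, phiTerm P β n x ≤ r * (1 - r)⁻¹ :=
      hgeom.tsum_eq ▸ (hsum x).tsum_le_tsum (fun n => hle n x) hgeom.summable
    have h1 : 1 / (1 - r) = 1 + r * (1 - r)⁻¹ := by
      have : 1 - r ≠ 0 := by linarith
      field_simp
      ring
    rw [h1]
    exact add_le_add_right h 1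
  have hvar : eVariationOn (phiFun P β) (Set.Icc 0 1) ≤
      ENNReal.ofReal (phiFun P β 0 - phiFun P β 1) := by
    simpa using (hanti.eVariationOn_inter_Icc (a := 0) (b := 1) (by simp) (by simp)).le
  refine ⟨hsum, fun x hx y hy hxy => hanti hx hy hxy,
    ne_top_of_le_ne_top ENNReal.ofReal_ne_top hvar, ?_⟩
  have hL1 : ∫ x in Set.Icc (0 : ℝ) 1, |phiFun P β x| ≤ 1 / (1 - r) := by
    have h := norm_setIntegral_le_of_norm_le_const (μ := volume) (s := Set.Icc (0 : ℝ) 1)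
      (f := fun x => |phiFun P β x|) (C := 1 / (1 - r)) (by simp)
      fun x _ => by simpa [abs_of_nonneg (hnonneg x)] using hbound x
    exact (Real.le_norm_self _).trans (by simpa using h)
  have hV : (eVariationOn (phiFun P β) (Set.Icc 0 1)).toReal ≤ 1 / (1 - r) :=
    calc
      _ ≤ phiFun P β 0 - phiFun P β 1 := ENNReal.toReal_le_of_le_ofReal
          (sub_nonneg.2 (hanti (by simp) (by simp) zero_le_one)) hvar
      _ ≤ 1 / (1 - r) := (sub_le_self _ (hnonneg 1)).trans (hbound 0)
  calc
    _ ≤ 1 / (1 - r) + 1 / (1 - r) := add_le_add hL1 hV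
    _ = 2 / (1 - r) := by ring
end

section
/- Let (Ω̂, F̂, P̂) be a probability space and β̂ : Ω̂ → (0,∞) measurable with ∫_{Ω̂} (1/β̂(a)) dP̂(a) < 1. Then ∫_{Ω̂} (⌊β̂(ω₀)⌋/β̂(ω₀)) dP̂(ω₀) + ∑_{n=1}^∞ ∫_{Ω̂^{n+1}} ⌊β̂(ω₀) · τ_{ω₁…ω_n}(1)⌋ / (∏_{i=0}^n β̂(ω_i)) dP̂^{n+1}(ω₀ω₁…ω_n) = 1. -/
open MeasureTheory

/-- The integrand `τ_{ω₁…ω_n}(1) / (β(ω₁) ⋯ β(ω_n))`. -/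
noncomputable def tauQuot {Ω : Type*} (β : Ω → ℝ) (n : ℕ) (w : Fin n → Ω) : ℝ :=
  tauList (List.ofFn fun i => β (w i)) 1 / ∏ i, β (w i)

lemma tauList_ofFn_succ {n : ℕ} (b : Fin (n + 1) → ℝ) (x : ℝ) :
    tauList (List.ofFn b) x =
      Int.fract (b (Fin.last n) * tauList (List.ofFn fun i : Fin n => b i.castSucc) x) := by
  rw [tauList, List.ofFn_succ', List.concat_eq_append, List.foldl_concat]
  rfl

lemma tauList_ofFn_mem_Icc {n : ℕ} (b : Fin n → ℝ) :
    tauList (List.ofFn b) 1 ∈ Set.Icc (0 : ℝ) 1 := by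
  cases n with
  | zero => simp [tauList]
  | succ n =>
    rw [tauList_ofFn_succ]
    exact ⟨Int.fract_nonneg _, (Int.fract_lt_one _).le⟩

lemma measurable_tauList_ofFn_s5 {Ω : Type*} [MeasurableSpace Ω] {n : ℕ} {b : Fin n → Ω → ℝ}
    (hb : ∀ i, Measurable (b i)) (x : ℝ) :
    Measurable fun w => tauList (List.ofFn fun i => b i w) x := by
  induction n with
  | zero => simp [tauList]
  | succ n ih =>
    simp only [tauList_ofFn_succ]
    exact ((hb _).mul (ih fun i => hb i.castSucc)).fract

lemma measurable_tauQuot {Ω : Type*} [MeasurableSpace Ω] {β : Ω → ℝ} (hβ : Measurable β) (n : ℕ) :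
    Measurable (tauQuot β n) :=
  (measurable_tauList_ofFn_s5 (fun i => hβ.comp (measurable_pi_apply i)) 1).div
    (Finset.measurable_prod _ fun i _ => hβ.comp (measurable_pi_apply i))

lemma tauQuot_nonneg {Ω : Type*} {β : Ω → ℝ} (hβ : ∀ a, 0 < β a) {n : ℕ} (w : Fin n → Ω) :
    0 ≤ tauQuot β n w :=
  div_nonneg (tauList_ofFn_mem_Icc _).1 (Finset.prod_nonneg fun _ _ => (hβ _).le)

lemma tauQuot_le {Ω : Type*} {β : Ω → ℝ} (hβ : ∀ a, 0 < β a) {n : ℕ} (w : Fin n → Ω) :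
    tauQuot β n w ≤ ∏ i, (β (w i))⁻¹ := by
  rw [tauQuot, div_eq_mul_inv, ← Finset.prod_inv_distrib]
  exact mul_le_of_le_one_left (Finset.prod_nonneg fun _ _ => (inv_pos.2 (hβ _)).le)
    (tauList_ofFn_mem_Icc _).2

lemma floor_mul_tauList_div {Ω : Type*} {β : Ω → ℝ} (hβ : ∀ a, 0 < β a) {n : ℕ}
    (w : Fin (n + 1) → Ω) :
    (⌊β (w 0) * tauList (List.ofFn fun i : Fin n => β (w i.succ)) 1⌋ : ℝ) / ∏ i, β (w i) =
      tauQuot β n (fun i => w i.succ) - tauQuot β (n + 1) (fun i => w (finRotate (n + 1) i)) := by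
  have h0 := (hβ (w 0)).ne'
  have hprod : (∏ i : Fin n, β (w i.succ)) ≠ 0 :=
    Finset.prod_ne_zero_iff.2 fun i _ => (hβ _).ne'
  have hlast : finRotate (n + 1) (Fin.last n) = 0 := finRotate_last
  have hrot (i : Fin n) : finRotate (n + 1) i.castSucc = i.succ := by
    simp
  have hperm : ∏ i, β (w (finRotate (n + 1) i)) = ∏ i, β (w i) :=
    Equiv.prod_comp (finRotate (n + 1)) fun i => β (w i)
  rw [tauQuot, tauQuot, hperm, tauList_ofFn_succ, Fin.prod_univ_succ]
  simp only [hlast, hrot, Int.fract]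
  field_simp
  ring

lemma integral_comp_of_measurePreserving {X Y : Type*} [MeasurableSpace X] [MeasurableSpace Y]
    {μ : Measure X} {ν : Measure Y} {f : X → Y} {g : Y → ℝ} (hf : MeasurePreserving f μ ν)
    (hg : Measurable g) : ∫ x, g (f x) ∂μ = ∫ y, g y ∂ν := by
  rw [← hf.map_eq, integral_map hf.aemeasurable hg.aestronglyMeasurable]

section Integral

variable {Ω : Type*} [MeasurableSpace Ω] {P : Measure Ω} [IsProbabilityMeasure P] {β : Ω → ℝ}

lemma integrable_tauQuot (hβmeas : Measurable β) (hβpos : ∀ a, 0 < β a)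
    (hint : Integrable (fun a => (β a)⁻¹) P) (n : ℕ) :
    Integrable (tauQuot β n) (Measure.pi fun _ => P) := by
  refine (Integrable.fintype_prod (f := fun (_ : Fin n) a => (β a)⁻¹) fun _ => hint).mono'
    (measurable_tauQuot hβmeas n).aestronglyMeasurable (.of_forall fun w => ?_)
  rw [Real.norm_of_nonneg (tauQuot_nonneg hβpos w)]
  exact tauQuot_le hβpos w

lemma integral_tauQuot_le (hβmeas : Measurable β) (hβpos : ∀ a, 0 < β a)
    (hint : Integrable (fun a => (β a)⁻¹) P) (n : ℕ) :
    ∫ w, tauQuot β n w ∂(Measure.pi fun _ => P) ≤ (∫ a, (β a)⁻¹ ∂P) ^ n := by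
  calc ∫ w, tauQuot β n w ∂(Measure.pi fun _ => P)
      ≤ ∫ w : Fin n → Ω, ∏ i, (β (w i))⁻¹ ∂(Measure.pi fun _ => P) :=
        integral_mono (integrable_tauQuot hβmeas hβpos hint n)
          (Integrable.fintype_prod (f := fun (_ : Fin n) a => (β a)⁻¹) fun _ => hint)
          fun w => tauQuot_le hβpos w
    _ = (∫ a, (β a)⁻¹ ∂P) ^ n := by
        rw [integral_fintype_prod_eq_pow (fun a => (β a)⁻¹), Fintype.card_fin]

lemma summable_integral_tauQuot (hβmeas : Measurable β) (hβpos : ∀ a, 0 < β a)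
    (hint : Integrable (fun a => (β a)⁻¹) P) (hr1 : ∫ a, (β a)⁻¹ ∂P < 1) :
    Summable fun n => ∫ w, tauQuot β n w ∂(Measure.pi fun _ => P) :=
  .of_nonneg_of_le (fun _ => integral_nonneg fun w => tauQuot_nonneg hβpos w)
    (integral_tauQuot_le hβmeas hβpos hint)
    (summable_geometric_of_lt_one (integral_nonneg fun a => (inv_pos.2 (hβpos a)).le) hr1)

lemma measurePreserving_tail (n : ℕ) :
    MeasurePreserving (fun (w : Fin (n + 1) → Ω) (i : Fin n) => w i.succ)
      (Measure.pi fun _ => P) (Measure.pi fun _ => P) :=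
  measurePreserving_snd.comp (measurePreserving_piFinSuccAbove (fun _ => P) 0)

lemma measurePreserving_comp_perm {n : ℕ} (e : Equiv.Perm (Fin n)) :
    MeasurePreserving (fun (w : Fin n → Ω) i => w (e i))
      (Measure.pi fun _ => P) (Measure.pi fun _ => P) :=
  measurePreserving_arrowCongr' (fun _ => P) (fun _ => P) e.symm (MeasurableEquiv.refl Ω)
    fun _ => .id P

lemma integral_floor_mul_tauList_div (hβmeas : Measurable β) (hβpos : ∀ a, 0 < β a)
    (hint : Integrable (fun a => (β a)⁻¹) P) (n : ℕ) :
    ∫ w : Fin (n + 1) → Ω,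
        (⌊β (w 0) * tauList (List.ofFn fun i : Fin n => β (w i.succ)) 1⌋ : ℝ) / ∏ i, β (w i)
        ∂(Measure.pi fun _ => P) =
      (∫ w, tauQuot β n w ∂(Measure.pi fun _ => P)) -
        ∫ w, tauQuot β (n + 1) w ∂(Measure.pi fun _ => P) := by
  have htail := measurePreserving_tail (P := P) n
  have hrot := measurePreserving_comp_perm (P := P) (finRotate (n + 1))
  have hn := integrable_tauQuot hβmeas hβpos hint n
  have hn1 := integrable_tauQuot hβmeas hβpos hint (n + 1)
  simp only [floor_mul_tauList_div hβpos]
  refine (integral_sub (htail.integrable_comp_of_integrable hn)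
    (hrot.integrable_comp_of_integrable hn1)).trans ?_
  congr 1
  · exact integral_comp_of_measurePreserving htail (measurable_tauQuot hβmeas n)
  · exact integral_comp_of_measurePreserving hrot (measurable_tauQuot hβmeas (n + 1))

lemma integral_floor_div (hβmeas : Measurable β) (hβpos : ∀ a, 0 < β a)
    (hint : Integrable (fun a => (β a)⁻¹) P) :
    ∫ a, (⌊β a⌋ : ℝ) / β a ∂P = 1 - ∫ w, tauQuot β 1 w ∂(Measure.pi fun _ => P) := by
  have h := integral_floor_mul_tauList_div hβmeas hβpos hint 0
  have heval := measurePreserving_eval (fun _ : Fin 1 => P) 0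
  have hm : Measurable fun a => (⌊β a⌋ : ℝ) / β a :=
    (measurable_from_top.comp hβmeas.floor).div hβmeas
  rw [← integral_comp_of_measurePreserving heval hm]
  simpa [tauList, tauQuot] using h

end Integral

/-- If `∫ 1/β̂ dP̂ < 1` then
`∫ ⌊β̂(ω₀)⌋/β̂(ω₀) dP̂ + ∑_{n=1}^∞ ∫_{Ω̂^{n+1}} ⌊β̂(ω₀) τ_{ω₁…ω_n}(1)⌋ / ∏_{i=0}^n β̂(ωᵢ) dP̂^{n+1} = 1`. -/
theorem stmt_5 {Ω : Type*} [MeasurableSpace Ω] (P : Measure Ω) [IsProbabilityMeasure P]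
    (β : Ω → ℝ) (hβmeas : Measurable β) (hβpos : ∀ a, 0 < β a)
    (hint : Integrable (fun a => (β a)⁻¹) P)
    (hr1 : ∫ a, (β a)⁻¹ ∂P < 1) :
    (∫ a, (⌊β a⌋ : ℝ) / β a ∂P)
      + (∑' n : ℕ, ∫ w : Fin (n + 2) → Ω,
          (⌊β (w 0) * tauList (List.ofFn fun i : Fin (n + 1) => β (w i.succ)) 1⌋ : ℝ) /
            ∏ i, β (w i)
          ∂(Measure.pi fun _ => P)) = 1 := by
  have hsum := (summable_nat_add_iff 1).2 (summable_integral_tauQuot hβmeas hβpos hint hr1)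
  have hsum' := (summable_nat_add_iff 1).2 hsum
  simp only [integral_floor_mul_tauList_div hβmeas hβpos hint]
  rw [integral_floor_div hβmeas hβpos hint, hsum.tsum_sub hsum', hsum.tsum_eq_zero_add]
  ring
end

section
/- Let 0 < β₀ ≤ β₁ with β₁ > 1. For every z ∈ ℂ with |z|/β₁ + |1−z|/β₀ < 1, the series φ(z) = 𝟙_{[0,1]} + ∑_{n=1}^∞ ∑_{w ∈ {0,1}^n} (z/β₁)^{k(w)} ((1−z)/β₀)^{n−k(w)} 𝟙_{[0, τ_w(1)]} converges absolutely in BV norm, and ‖φ(z)‖_{BV} ≤ 2 + 2/(1 − (|z|/β₁ + |1−z|/β₀)). -/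
open MeasureTheory
open scoped ENNReal

/-- `τ_w` for a word `w ∈ {0,1}^n`: apply `T_{β_{w₁}}` first, …, `T_{β_{w_n}}` last, where
`T_α y = Int.fract (α * y)` and `β_{w_i} = β₁` if `w_i = 1`, `β₀` otherwise. -/
noncomputable def tauWord {n : ℕ} (β₀ β₁ : ℝ) (w : Fin n → Bool) (x : ℝ) : ℝ :=
  (List.ofFn fun i => if w i then β₁ else β₀).foldl (fun y b => Int.fract (b * y)) x

/-- `k(w) = ∑ᵢ wᵢ`, the number of ones in the word `w`. -/
def kWord {n : ℕ} (w : Fin n → Bool) : ℕ := (Finset.univ.filter fun i => w i = true).card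

/-- The BV "norm" `‖f‖_{BV} = ‖f‖_{L¹([0,1])} + Var_{[0,1]}(f)`, valued in `ℝ≥0∞`. -/
noncomputable def bvNorm (f : ℝ → ℂ) : ℝ≥0∞ :=
  ENNReal.ofReal (∫ x in Set.Icc (0:ℝ) 1, ‖f x‖) + eVariationOn f (Set.Icc 0 1)

/-- Countable subadditivity of the variation along a pointwise summable family. -/
theorem eVariationOn_tsum_le {α ι E : Type*} [LinearOrder α] [NormedAddCommGroup E]
    {f : ι → α → E} {s : Set α} (hf : ∀ x ∈ s, Summable fun i => f i x) :
    eVariationOn (fun x => ∑' i, f i x) s ≤ ∑' i, eVariationOn (f i) s := by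
  refine iSup_le fun p => ?_
  calc
    _ ≤ ∑ j ∈ Finset.range p.1, ∑' i, edist (f i (p.2.1 (j + 1))) (f i (p.2.1 j)) := by
      refine Finset.sum_le_sum fun j _ => ?_
      simp only [edist_eq_enorm_sub]
      rw [← (hf _ (p.2.2.2 _)).tsum_sub (hf _ (p.2.2.2 _))]
      exact enorm_tsum_le_tsum_enorm
    _ = ∑' i, ∑ j ∈ Finset.range p.1, edist (f i (p.2.1 (j + 1))) (f i (p.2.1 j)) :=
      (Summable.tsum_finsetSum fun _ _ => ENNReal.summable).symm
    _ ≤ _ := ENNReal.tsum_le_tsum fun i =>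
      le_iSup (fun q : ℕ × {u : ℕ → α // Monotone u ∧ ∀ i, u i ∈ s} =>
        ∑ j ∈ Finset.range q.1, edist (f i (q.2.1 (j + 1))) (f i (q.2.1 j))) p

theorem eVariationOn_add_le {α E : Type*} [LinearOrder α] [NormedAddCommGroup E]
    (f g : α → E) (s : Set α) :
    eVariationOn (fun x => f x + g x) s ≤ eVariationOn f s + eVariationOn g s := by
  simpa [tsum_fintype] using
    eVariationOn_tsum_le (f := fun b : Bool => if b then f else g) (s := s)
      fun _ _ => (hasSum_fintype _).summable

theorem eVariationOn_sum_le {α ι E : Type*} [LinearOrder α] [NormedAddCommGroup E] [Fintype ι]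
    (f : ι → α → E) (s : Set α) :
    eVariationOn (fun x => ∑ i, f i x) s ≤ ∑ i, eVariationOn (f i) s := by
  simpa only [tsum_fintype] using
    eVariationOn_tsum_le (f := f) (s := s) fun _ _ => (hasSum_fintype _).summable

theorem eVariationOn_const_mul_indicator_Icc_le (c : ℂ) (a : ℝ) :
    eVariationOn (fun x => c * Set.indicator (Set.Icc (0 : ℝ) a) (fun _ => (1 : ℂ)) x)
      (Set.Icc 0 1) ≤ ENNReal.ofReal ‖c‖ := by
  set h : ℝ → ℝ := fun x => 1 - Set.indicator (Set.Icc (0 : ℝ) a) (fun _ => (1 : ℝ)) x with hh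
  have h_mono : MonotoneOn h (Set.Icc 0 1) := by
    intro x hx y hy hxy
    simp only [hh, Set.indicator_apply, Set.mem_Icc]
    have := hx.1
    split_ifs <;> grind
  have h_var : eVariationOn h (Set.Icc 0 1) ≤ 1 := by
    have := h_mono.eVariationOn_eq (Set.left_mem_Icc.2 zero_le_one)
      (Set.right_mem_Icc.2 zero_le_one)
    rw [Set.inter_self] at this
    refine this.trans_le (ENNReal.ofReal_le_one.2 ?_)
    simp only [hh, Set.indicator_apply]
    split_ifs <;> norm_num
  have h_lip : LipschitzOnWith ‖c‖₊ (fun t : ℝ => c * (1 - (t : ℂ))) Set.univ := by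
    refine LipschitzWith.lipschitzOnWith (LipschitzWith.of_dist_le_mul fun x y => ?_)
    rw [dist_eq_norm, ← mul_sub, norm_mul, sub_sub_sub_cancel_left, ← Complex.ofReal_sub,
      Complex.norm_real, ← dist_eq_norm, dist_comm, coe_nnnorm]
  have h_comp := h_lip.comp_eVariationOn_le (g := h) (s := Set.Icc 0 1) (fun _ _ => Set.mem_univ _)
  have h_eq : (fun x => c * Set.indicator (Set.Icc (0 : ℝ) a) (fun _ => (1 : ℂ)) x) =
      (fun t : ℝ => c * (1 - (t : ℂ))) ∘ h := by
    funext x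
    simp only [hh, Set.indicator_apply, Function.comp]
    split_ifs <;> simp
  rw [h_eq]
  refine h_comp.trans ?_
  rw [ofReal_norm, ← enorm_eq_nnnorm]
  exact mul_le_of_le_one_right' h_var

theorem norm_const_mul_indicator_le (c : ℂ) (s : Set ℝ) (x : ℝ) :
    ‖c * Set.indicator s (fun _ => (1 : ℂ)) x‖ ≤ ‖c‖ := by
  by_cases hx : x ∈ s <;> simp [hx]

/-- If `f` is bounded by `C` on `[0,1]`, then its BV norm is at most `C` plus its variation. -/
theorem bvNorm_le_of_norm_le {f : ℝ → ℂ} {C : ℝ} {V : ℝ≥0∞} (hC : ∀ x, ‖f x‖ ≤ C)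
    (hV : eVariationOn f (Set.Icc 0 1) ≤ V) : bvNorm f ≤ ENNReal.ofReal C + V := by
  refine add_le_add (ENNReal.ofReal_le_ofReal ?_) hV
  have := norm_setIntegral_le_of_norm_le_const (μ := volume) (s := Set.Icc (0 : ℝ) 1)
    (f := fun x => ‖f x‖) (C := C) (by simp) (fun x _ => by simpa using hC x)
  exact (Real.le_norm_self _).trans (by simpa using this)

theorem sum_pow_kWord (n : ℕ) (A B : ℝ) :
    ∑ w : Fin n → Bool, A ^ kWord w * B ^ (n - kWord w) = (A + B) ^ n := by
  have h := Fintype.sum_pow (fun b : Bool => if b then A else B) n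
  simp only [Fintype.sum_bool, if_true, Bool.false_eq_true, if_false] at h
  rw [h]
  refine Finset.sum_congr rfl fun w _ => ?_
  rw [Finset.prod_ite, Finset.prod_const, Finset.prod_const, kWord]
  congr 2
  have := Finset.card_filter_add_card_filter_not (s := Finset.univ) (fun i => w i = true)
  simp only [Finset.card_univ, Fintype.card_fin] at this
  omega

/-- For `0 < β₀ ≤ β₁`, `β₁ > 1` and `z ∈ ℂ` with `|z|/β₁ + |1-z|/β₀ < 1`,
the series `φ(z) = 𝟙_{[0,1]} + ∑_n ∑_{w ∈ {0,1}^n} (z/β₁)^{k(w)} ((1-z)/β₀)^{n-k(w)} 𝟙_{[0,τ_w(1)]}`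
converges absolutely in BV norm, and `‖φ(z)‖_{BV} ≤ 2 + 2/(1 - (|z|/β₁ + |1-z|/β₀))`. -/
theorem stmt_8 (β₀ β₁ : ℝ) (h0 : 0 < β₀) (h01 : β₀ ≤ β₁) (h1 : 1 < β₁)
    (z : ℂ) (hz : ‖z‖ / β₁ + ‖1 - z‖ / β₀ < 1) :
    (∑' n : ℕ, ∑ w : Fin (n + 1) → Bool,
        bvNorm (fun x => (z / (β₁ : ℂ)) ^ kWord w * ((1 - z) / (β₀ : ℂ)) ^ (n + 1 - kWord w) *
          Set.indicator (Set.Icc (0:ℝ) (tauWord β₀ β₁ w 1)) (fun _ => (1:ℂ)) x)) ≠ ⊤ ∧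
    bvNorm (fun x => Set.indicator (Set.Icc (0:ℝ) 1) (fun _ => (1:ℂ)) x +
        ∑' n : ℕ, ∑ w : Fin (n + 1) → Bool,
          (z / (β₁ : ℂ)) ^ kWord w * ((1 - z) / (β₀ : ℂ)) ^ (n + 1 - kWord w) *
            Set.indicator (Set.Icc (0:ℝ) (tauWord β₀ β₁ w 1)) (fun _ => (1:ℂ)) x)
      ≤ ENNReal.ofReal (2 + 2 / (1 - (‖z‖ / β₁ + ‖1 - z‖ / β₀))) := by
  set A := ‖z‖ / β₁ with hA
  set B := ‖1 - z‖ / β₀ with hB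
  have hβ₁ : 0 < β₁ := zero_lt_one.trans h1
  have hr : 0 ≤ A + B := by positivity
  have h_norm (n : ℕ) (w : Fin (n + 1) → Bool) :
      ‖(z / (β₁ : ℂ)) ^ kWord w * ((1 - z) / (β₀ : ℂ)) ^ (n + 1 - kWord w)‖ =
        A ^ kWord w * B ^ (n + 1 - kWord w) := by
    simp [hA, hB, abs_of_pos h0, abs_of_pos hβ₁]
  have h_sum (n : ℕ) : ∑ w : Fin (n + 1) → Bool,
      ENNReal.ofReal ‖(z / (β₁ : ℂ)) ^ kWord w * ((1 - z) / (β₀ : ℂ)) ^ (n + 1 - kWord w)‖ =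
        ENNReal.ofReal ((A + B) ^ (n + 1)) := by
    rw [← ENNReal.ofReal_sum_of_nonneg fun _ _ => norm_nonneg _]
    simp only [h_norm, sum_pow_kWord]
  have h_geom : HasSum (fun n : ℕ => (A + B) ^ (n + 1)) ((A + B) / (1 - (A + B))) := by
    simpa [pow_succ', div_eq_mul_inv] using (hasSum_geometric_of_lt_one hr hz).mul_left (A + B)
  have h_tsum : ∑' n : ℕ, ENNReal.ofReal ((A + B) ^ (n + 1)) =
      ENNReal.ofReal ((A + B) / (1 - (A + B))) := by
    rw [← ENNReal.ofReal_tsum_of_nonneg (fun _ => by positivity) h_geom.summable, h_geom.tsum_eq]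
  have h_level (n : ℕ) (x : ℝ) : ‖∑ w : Fin (n + 1) → Bool,
      (z / (β₁ : ℂ)) ^ kWord w * ((1 - z) / (β₀ : ℂ)) ^ (n + 1 - kWord w) *
        Set.indicator (Set.Icc (0:ℝ) (tauWord β₀ β₁ w 1)) (fun _ => (1:ℂ)) x‖ ≤
      (A + B) ^ (n + 1) := by
    refine (norm_sum_le _ _).trans ?_
    rw [← sum_pow_kWord]
    refine Finset.sum_le_sum fun w _ => ?_
    rw [← h_norm]
    exact norm_const_mul_indicator_le _ _ _
  have h_level_var (n : ℕ) : eVariationOn (fun x => ∑ w : Fin (n + 1) → Bool,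
      (z / (β₁ : ℂ)) ^ kWord w * ((1 - z) / (β₀ : ℂ)) ^ (n + 1 - kWord w) *
        Set.indicator (Set.Icc (0:ℝ) (tauWord β₀ β₁ w 1)) (fun _ => (1:ℂ)) x) (Set.Icc 0 1) ≤
      ENNReal.ofReal ((A + B) ^ (n + 1)) := by
    rw [← h_sum]
    exact (eVariationOn_sum_le _ _).trans
      (Finset.sum_le_sum fun w _ => eVariationOn_const_mul_indicator_Icc_le _ _)
  constructor
  · refine ne_top_of_le_ne_top
      (b := 2 * ENNReal.ofReal ((A + B) / (1 - (A + B)))) (ENNReal.mul_ne_top ENNReal.ofNat_ne_top ENNReal.ofReal_ne_top) ?_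
    rw [← h_tsum, ← ENNReal.tsum_mul_left]
    refine ENNReal.tsum_le_tsum fun n => ?_
    rw [← h_sum, Finset.mul_sum]
    refine Finset.sum_le_sum fun w _ => ?_
    rw [two_mul]
    exact bvNorm_le_of_norm_le (norm_const_mul_indicator_le _ _)
      (eVariationOn_const_mul_indicator_Icc_le _ _)
  · have hpos : 0 < 1 - (A + B) := sub_pos.2 hz
    have hq : 0 ≤ (A + B) / (1 - (A + B)) := by positivity
    have h_ind (x : ℝ) : ‖Set.indicator (Set.Icc (0:ℝ) 1) (fun _ => (1:ℂ)) x‖ ≤ 1 := by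
      simpa using norm_const_mul_indicator_le 1 (Set.Icc (0:ℝ) 1) x
    refine (bvNorm_le_of_norm_le (C := 1 + (A + B) / (1 - (A + B)))
      (V := ENNReal.ofReal 1 + ENNReal.ofReal ((A + B) / (1 - (A + B))))
      (fun x => ?_) ?_).trans ?_
    · exact (norm_add_le _ _).trans
        (add_le_add (h_ind x) (tsum_of_norm_bounded h_geom fun n => h_level n x))
    · refine (eVariationOn_add_le _ _ _).trans (add_le_add ?_ ?_)
      · simpa using eVariationOn_const_mul_indicator_Icc_le 1 1
      · refine (eVariationOn_tsum_le fun x _ => ?_).trans ?_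
        · exact Summable.of_norm_bounded h_geom.summable fun n => h_level n x
        rw [← h_tsum]
        exact ENNReal.tsum_le_tsum h_level_var
    · rw [← ENNReal.ofReal_add zero_le_one hq, ← ENNReal.ofReal_add (by positivity) (by positivity)]
      refine ENNReal.ofReal_le_ofReal ?_
      have : (A + B) / (1 - (A + B)) = 1 / (1 - (A + B)) - 1 := by field_simp; ring
      rw [this]
      ring_nf
      linarith
end

section
/- In the invertible setting with γ := essinf β > 1, for every f ∈ L¹(P) the series (Tf)(ω) = ∑_{n=1}^∞ (d_n(θ^{−n}ω, 1)/β^{(n)}_{θ^{−n}ω}) f(θ^{−n}ω) and (Sf)(ω) = ∑_{n=1}^∞ (τ^n_{θ^{−n}ω}(1)/β^{(n)}_{θ^{−n}ω}) f(θ^{−n}ω) converge absolutely for P-a.e. ω, define elements of L¹(P), and satisfy ∫_Ω |Tf| dP ≤ ∫_Ω |f| dP and ∫_Ω |Sf| dP ≤ (γ − 1)^{-1} ∫_Ω |f| dP. -/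
open MeasureTheory Filter

/-- The forward orbit of `1`: `orb β θ ω n = τ_ω^n(1)` where `τ_ω = T_{β(ω)}`,
`τ_ω^n = τ_{θ^{n-1}ω} ∘ ⋯ ∘ τ_ω` and `T_α y = Int.fract (α * y)`. -/
noncomputable def orb {Ω : Type*} (β : Ω → ℝ) (θ : Ω → Ω) (ω : Ω) : ℕ → ℝ
  | 0 => 1
  | n + 1 => Int.fract (β (θ^[n] ω) * orb β θ ω n)

/-- `bprod β θ ω n = β_ω^{(n)} = ∏_{i=0}^{n-1} β (θ^i ω)`. -/
noncomputable def bprod {Ω : Type*} (β : Ω → ℝ) (θ : Ω → Ω) (ω : Ω) (n : ℕ) : ℝ :=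
  ∏ i ∈ Finset.range n, β (θ^[i] ω)

/-- `Tcoef β θ ω n = d_{n+1}(ω, 1) / β_ω^{(n+1)}`, where
`d_{n+1}(ω, 1) = ⌊β(θ^n ω) · τ_ω^n(1)⌋`. -/
noncomputable def Tcoef {Ω : Type*} (β : Ω → ℝ) (θ : Ω → Ω) (ω : Ω) (n : ℕ) : ℝ :=
  (⌊β (θ^[n] ω) * orb β θ ω n⌋ : ℝ) / bprod β θ ω (n + 1)

/-- `Scoef β θ ω n = τ_ω^{n+1}(1) / β_ω^{(n+1)}`. -/
noncomputable def Scoef {Ω : Type*} (β : Ω → ℝ) (θ : Ω → Ω) (ω : Ω) (n : ℕ) : ℝ :=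
  orb β θ ω (n + 1) / bprod β θ ω (n + 1)

/-- The operator `T`: `(Tf)(ω) = ∑_{n=1}^∞ (d_n(θ^{-n}ω, 1)/β^{(n)}_{θ^{-n}ω}) f(θ^{-n}ω)`,
with `θ^{-n}` realized by iterating the inverse `θinv`. -/
noncomputable def TOp {Ω : Type*} (β : Ω → ℝ) (θ θinv : Ω → Ω) (f : Ω → ℝ) (ω : Ω) : ℝ :=
  ∑' n : ℕ, Tcoef β θ (θinv^[n + 1] ω) n * f (θinv^[n + 1] ω)

/-- The operator `S`: `(Sf)(ω) = ∑_{n=1}^∞ (τ^n_{θ^{-n}ω}(1)/β^{(n)}_{θ^{-n}ω}) f(θ^{-n}ω)`. -/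
noncomputable def SOp {Ω : Type*} (β : Ω → ℝ) (θ θinv : Ω → Ω) (f : Ω → ℝ) (ω : Ω) : ℝ :=
  ∑' n : ℕ, Scoef β θ (θinv^[n + 1] ω) n * f (θinv^[n + 1] ω)

theorem bprod_pos {Ω : Type*} {β : Ω → ℝ} {θ : Ω → Ω} (hβ : ∀ ω, 0 < β ω) (ω : Ω) (n : ℕ) :
    0 < bprod β θ ω n :=
  Finset.prod_pos fun _ _ => hβ _

theorem orb_nonneg {Ω : Type*} (β : Ω → ℝ) (θ : Ω → Ω) (ω : Ω) (n : ℕ) : 0 ≤ orb β θ ω n := by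
  cases n with
  | zero => exact zero_le_one
  | succ n => exact Int.fract_nonneg _

theorem Tcoef_nonneg {Ω : Type*} {β : Ω → ℝ} {θ : Ω → Ω} (hβ : ∀ ω, 0 < β ω) (ω : Ω) (n : ℕ) :
    0 ≤ Tcoef β θ ω n := by
  refine div_nonneg ?_ (bprod_pos hβ ω _).le
  exact_mod_cast Int.floor_nonneg.2 (mul_nonneg (hβ _).le (orb_nonneg β θ ω n))

theorem Scoef_nonneg {Ω : Type*} {β : Ω → ℝ} {θ : Ω → Ω} (hβ : ∀ ω, 0 < β ω) (ω : Ω) (n : ℕ) :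
    0 ≤ Scoef β θ ω n :=
  div_nonneg (orb_nonneg β θ ω _) (bprod_pos hβ ω _).le

/-- The partial sums of the greedy expansion of `1`. -/
theorem sum_Tcoef {Ω : Type*} {β : Ω → ℝ} {θ : Ω → Ω} (hβ : ∀ ω, 0 < β ω) (ω : Ω) (N : ℕ) :
    ∑ n ∈ Finset.range N, Tcoef β θ ω n = 1 - orb β θ ω N / bprod β θ ω N := by
  induction N with
  | zero => simp [orb, bprod]
  | succ N ih =>
    have hb := (bprod_pos (θ := θ) hβ ω N).ne'
    have hβN := (hβ (θ^[N] ω)).ne'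
    have hprod : bprod β θ ω (N + 1) = bprod β θ ω N * β (θ^[N] ω) := Finset.prod_range_succ _ _
    have horb : orb β θ ω (N + 1) =
        β (θ^[N] ω) * orb β θ ω N - ⌊β (θ^[N] ω) * orb β θ ω N⌋ := rfl
    rw [Finset.sum_range_succ, ih, Tcoef, horb, hprod]
    field_simp
    ring

theorem sum_Tcoef_le_one {Ω : Type*} {β : Ω → ℝ} {θ : Ω → Ω} (hβ : ∀ ω, 0 < β ω) (ω : Ω) (N : ℕ) :
    ∑ n ∈ Finset.range N, Tcoef β θ ω n ≤ 1 := by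
  rw [sum_Tcoef hβ]
  exact sub_le_self _ (div_nonneg (orb_nonneg β θ ω N) (bprod_pos hβ ω N).le)

theorem sum_Scoef_le {Ω : Type*} {β : Ω → ℝ} {θ : Ω → Ω} {γ : ℝ} (hγ : 1 < γ) (ω : Ω)
    (h : ∀ n, γ ≤ β (θ^[n] ω)) (N : ℕ) :
    ∑ n ∈ Finset.range N, Scoef β θ ω n ≤ (γ - 1)⁻¹ := by
  have hγ0 : 0 < γ := zero_lt_one.trans hγ
  have hcoef : ∀ n, Scoef β θ ω n ≤ γ⁻¹ * γ⁻¹ ^ n := fun n => by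
    have hpow : γ ^ (n + 1) ≤ bprod β θ ω (n + 1) := by
      simpa [bprod] using
        Finset.prod_le_prod (s := Finset.range (n + 1)) (fun _ _ => hγ0.le) fun i _ => h i
    calc Scoef β θ ω n ≤ 1 / γ ^ (n + 1) :=
          div_le_div₀ zero_le_one (Int.fract_lt_one _).le (by positivity) hpow
      _ = γ⁻¹ * γ⁻¹ ^ n := by rw [one_div, ← inv_pow, pow_succ']
  have hsum : HasSum (fun n : ℕ => γ⁻¹ * γ⁻¹ ^ n) (γ - 1)⁻¹ := by
    have hne : γ - 1 ≠ 0 := (sub_pos.2 hγ).ne'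
    have := (hasSum_geometric_of_lt_one (inv_nonneg.2 hγ0.le) (inv_lt_one_of_one_lt₀ hγ)).mul_left γ⁻¹
    rwa [← mul_inv, mul_sub, mul_one, mul_inv_cancel₀ hγ0.ne'] at this
  exact (Finset.sum_le_sum fun n _ => hcoef n).trans
    (sum_le_hasSum _ (fun n _ => by positivity) hsum)

section Measurability

variable {Ω : Type*} [MeasurableSpace Ω] {β : Ω → ℝ} {θ : Ω → Ω}

theorem measurable_orb (hβ : Measurable β) (hθ : Measurable θ) (n : ℕ) :
    Measurable fun ω => orb β θ ω n := by
  induction n with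
  | zero => exact measurable_const
  | succ n ih => exact ((hβ.comp (hθ.iterate n)).mul ih).fract

theorem measurable_bprod (hβ : Measurable β) (hθ : Measurable θ) (n : ℕ) :
    Measurable fun ω => bprod β θ ω n :=
  Finset.measurable_fun_prod _ fun i _ => hβ.comp (hθ.iterate i)

theorem measurable_Tcoef (hβ : Measurable β) (hθ : Measurable θ) (n : ℕ) :
    Measurable fun ω => Tcoef β θ ω n :=
  (measurable_from_top.comp
    ((hβ.comp (hθ.iterate n)).mul (measurable_orb hβ hθ n)).floor).div
    (measurable_bprod hβ hθ (n + 1))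

theorem measurable_Scoef (hβ : Measurable β) (hθ : Measurable θ) (n : ℕ) :
    Measurable fun ω => Scoef β θ ω n :=
  (measurable_orb hβ hθ (n + 1)).div (measurable_bprod hβ hθ (n + 1))

end Measurability

/-- A series of `L¹` functions whose norms have a finite sum of integrals converges absolutely
almost everywhere, to an integrable function. -/
theorem summable_integrable_tsum_of_tsum_lintegral_le {Ω : Type*} [MeasurableSpace Ω]
    {P : Measure Ω} {g : ℕ → Ω → ℝ} (hg : ∀ n, AEStronglyMeasurable (g n) P) {K : ℝ} (hK : 0 ≤ K)
    (h : ∑' n, ∫⁻ ω, ‖g n ω‖ₑ ∂P ≤ ENNReal.ofReal K) :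
    (∀ᵐ ω ∂P, Summable fun n => |g n ω|) ∧ Integrable (fun ω => ∑' n, g n ω) P ∧
      ∫ ω, |∑' n, g n ω| ∂P ≤ K := by
  rw [← lintegral_tsum fun n => (hg n).enorm] at h
  have hsum : ∀ᵐ ω ∂P, Summable fun n => |g n ω| := by
    filter_upwards [ae_lt_top' (AEMeasurable.tsum fun n => (hg n).enorm)
      (h.trans_lt ENNReal.ofReal_lt_top).ne] with ω hω
    exact tsum_enorm_ne_top_iff_summable_norm.1 hω.ne
  have hmeas : AEStronglyMeasurable (fun ω => ∑' n, g n ω) P := by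
    refine aestronglyMeasurable_of_tendsto_ae (u := atTop)
      (f := fun N ω => ∑ n ∈ Finset.range N, g n ω)
      (fun N => Finset.aestronglyMeasurable_fun_sum _ fun n _ => hg n) ?_
    filter_upwards [hsum] with ω hω
    exact hω.of_abs.hasSum.tendsto_sum_nat
  have hbound : ∫⁻ ω, ‖∑' n, g n ω‖ₑ ∂P ≤ ENNReal.ofReal K :=
    (lintegral_mono fun ω => enorm_tsum_le_tsum_enorm).trans h
  refine ⟨hsum, ⟨hmeas, hbound.trans_lt ENNReal.ofReal_lt_top⟩, ?_⟩
  simp_rw [← Real.norm_eq_abs]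
  rw [integral_norm_eq_lintegral_enorm hmeas]
  exact ENNReal.toReal_le_of_le_ofReal hK hbound

/-- A weighted sum along the backward orbit is controlled by the forward sums of the weights. -/
theorem summable_integrable_tsum_comp_iterate {Ω : Type*} [MeasurableSpace Ω] {P : Measure Ω}
    {φ : Ω → Ω} (hφ : MeasurePreserving φ P P) {c : Ω → ℕ → ℝ}
    (hc : ∀ n, Measurable fun ω => c ω n) (hc0 : ∀ ω n, 0 ≤ c ω n) {C : ℝ} (hC : 0 ≤ C)
    (hcC : ∀ᵐ ω ∂P, ∀ N, ∑ n ∈ Finset.range N, c ω n ≤ C) {f : Ω → ℝ} (hf : Integrable f P) :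
    (∀ᵐ ω ∂P, Summable fun n : ℕ => |c (φ^[n + 1] ω) n * f (φ^[n + 1] ω)|) ∧
      Integrable (fun ω => ∑' n : ℕ, c (φ^[n + 1] ω) n * f (φ^[n + 1] ω)) P ∧
      ∫ ω, |∑' n : ℕ, c (φ^[n + 1] ω) n * f (φ^[n + 1] ω)| ∂P ≤ C * ∫ ω, |f ω| ∂P := by
  have hcf : ∀ n, AEStronglyMeasurable (fun ω => c ω n * f ω) P := fun n =>
    (hc n).aestronglyMeasurable.mul hf.1
  refine summable_integrable_tsum_of_tsum_lintegral_le
    (fun n => (hcf n).comp_measurePreserving (hφ.iterate (n + 1)))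
    (mul_nonneg hC (integral_nonneg fun _ => abs_nonneg _)) ?_
  have hcomp : ∀ n, ∫⁻ ω, ‖c (φ^[n + 1] ω) n * f (φ^[n + 1] ω)‖ₑ ∂P =
      ∫⁻ ω, ‖c ω n * f ω‖ₑ ∂P := fun n => by
    have hmp := hφ.iterate (n + 1)
    conv_rhs => rw [← hmp.map_eq]
    rw [lintegral_map' (by rw [hmp.map_eq]; exact (hcf n).enorm) hmp.measurable.aemeasurable]
  refine (tsum_congr hcomp).le.trans ?_
  rw [← lintegral_tsum fun n => (hcf n).enorm]
  calc ∫⁻ ω, ∑' n, ‖c ω n * f ω‖ₑ ∂P ≤ ∫⁻ ω, ENNReal.ofReal C * ‖f ω‖ₑ ∂P := by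
        refine lintegral_mono_ae ?_
        filter_upwards [hcC] with ω hω
        simp_rw [enorm_mul]
        rw [ENNReal.tsum_mul_right]
        gcongr
        refine ENNReal.tsum_le_of_sum_range_le fun N => ?_
        simp_rw [Real.enorm_eq_ofReal (hc0 ω _)]
        rw [← ENNReal.ofReal_sum_of_nonneg fun n _ => hc0 ω n]
        exact ENNReal.ofReal_le_ofReal (hω N)
    _ = ENNReal.ofReal (C * ∫ ω, |f ω| ∂P) := by
        rw [lintegral_const_mul' _ _ ENNReal.ofReal_ne_top, ENNReal.ofReal_mul hC]
        congr 1
        exact (ofReal_integral_norm_eq_lintegral_enorm hf).symm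

/-- In the invertible setting with `γ := essinf β > 1`, for every
`f ∈ L¹(P)` the series defining `Tf` and `Sf` converge absolutely `P`-a.e., define elements
of `L¹(P)`, and `∫ |Tf| dP ≤ ∫ |f| dP`, `∫ |Sf| dP ≤ (γ - 1)⁻¹ ∫ |f| dP`. -/
theorem stmt_11 {Ω : Type*} [MeasurableSpace Ω] (P : Measure Ω) [IsProbabilityMeasure P]
    (θ θinv : Ω → Ω) (hθ : MeasurePreserving θ P P) (hθinv : MeasurePreserving θinv P P)
    (hli : Function.LeftInverse θinv θ) (hri : Function.RightInverse θinv θ)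
    (β : Ω → ℝ) (hβmeas : Measurable β) (hβpos : ∀ ω, 0 < β ω)
    (hγ : 1 < essInf β P)
    (f : Ω → ℝ) (hf : Integrable f P) :
    (∀ᵐ ω ∂P, Summable fun n : ℕ => |Tcoef β θ (θinv^[n + 1] ω) n * f (θinv^[n + 1] ω)|) ∧
    (∀ᵐ ω ∂P, Summable fun n : ℕ => |Scoef β θ (θinv^[n + 1] ω) n * f (θinv^[n + 1] ω)|) ∧
    Integrable (TOp β θ θinv f) P ∧
    Integrable (SOp β θ θinv f) P ∧
    (∫ ω, |TOp β θ θinv f ω| ∂P) ≤ ∫ ω, |f ω| ∂P ∧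
    (∫ ω, |SOp β θ θinv f ω| ∂P) ≤ (essInf β P - 1)⁻¹ * ∫ ω, |f ω| ∂P := by
  have hβγ : ∀ᵐ ω ∂P, ∀ n : ℕ, essInf β P ≤ β (θ^[n] ω) := by
    have hle : ∀ᵐ ω ∂P, essInf β P ≤ β ω :=
      ae_essInf_le (isBoundedUnder_of ⟨0, fun ω => (hβpos ω).le⟩)
    exact ae_all_iff.2 fun n => (hθ.iterate n).quasiMeasurePreserving.ae hle
  obtain ⟨hTsum, hTint, hTle⟩ := summable_integrable_tsum_comp_iterate hθinv
    (measurable_Tcoef hβmeas hθ.measurable) (Tcoef_nonneg hβpos) zero_le_one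
    (ae_of_all P (sum_Tcoef_le_one hβpos)) hf
  obtain ⟨hSsum, hSint, hSle⟩ := summable_integrable_tsum_comp_iterate hθinv
    (measurable_Scoef hβmeas hθ.measurable) (Scoef_nonneg hβpos)
    (inv_nonneg.2 (sub_pos.2 hγ).le) (hβγ.mono fun ω hω => sum_Scoef_le hγ ω hω) hf
  rw [one_mul] at hTle
  exact ⟨hTsum, hSsum, hTint, hSint, hTle, hSle⟩
end

section
/- In the invertible setting with γ := essinf β > 1, for every f ∈ L¹(P) the operator identity I − T = (I − U_{θ^{-1}})(I + S) holds at the level of functions: for P-a.e. ω ∈ Ω, f(ω) − (Tf)(ω) = (f + Sf)(ω) − (f + Sf)(θ^{-1}ω). -/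
open MeasureTheory Filter

lemma exists_one_lt_ae_le_of_one_lt_essInf {Ω : Type*} [MeasurableSpace Ω] {P : Measure Ω}
    {β : Ω → ℝ} (hγ : 1 < essInf β P) : ∃ a : ℝ, 1 < a ∧ ∀ᵐ ω ∂P, a ≤ β ω := by
  rw [essInf, liminf_eq] at hγ
  have hne : {a : ℝ | ∀ᵐ ω ∂P, a ≤ β ω}.Nonempty := by
    by_contra h
    rw [Set.not_nonempty_iff_eq_empty] at h
    rw [h, Real.sSup_empty] at hγ
    linarith
  obtain ⟨a, ha, h1⟩ := exists_lt_of_lt_csSup hne hγ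
  exact ⟨a, h1, ha⟩

/-- Geometrically weighted sums of an integrable function along the orbits of a
measure-preserving map converge almost everywhere. -/
lemma ae_summable_geometric_mul_iterate {Ω : Type*} [MeasurableSpace Ω] {P : Measure Ω}
    {φ : Ω → Ω} (hφ : MeasurePreserving φ P P) {r : ℝ} (hr0 : 0 ≤ r) (hr1 : r < 1)
    {f : Ω → ℝ} (hf : Integrable f P) :
    ∀ᵐ ω ∂P, Summable fun n : ℕ ↦ r ^ n * |f (φ^[n] ω)| := by
  lift r to NNReal using hr0
  have hm (n : ℕ) : AEMeasurable (fun ω ↦ ‖f (φ^[n] ω)‖ₑ) P :=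
    (hf.1.comp_measurePreserving (hφ.iterate n)).enorm
  have hint (n : ℕ) : ∫⁻ ω, ‖f (φ^[n] ω)‖ₑ ∂P = ∫⁻ ω, ‖f ω‖ₑ ∂P := by
    have h := (hφ.iterate n).map_eq
    conv_rhs => rw [← h]
    rw [lintegral_map' (by rw [h]; exact hf.1.enorm) (hφ.iterate n).aemeasurable]
  have hfin : ∫⁻ ω, ∑' n : ℕ, (r : ENNReal) ^ n * ‖f (φ^[n] ω)‖ₑ ∂P ≠ ⊤ := by
    rw [lintegral_tsum fun n ↦ (hm n).const_mul _]
    simp_rw [lintegral_const_mul'' _ (hm _), hint]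
    rw [ENNReal.tsum_mul_right, ENNReal.tsum_geometric]
    refine ENNReal.mul_ne_top ?_ hf.2.ne
    rw [ENNReal.inv_ne_top]
    exact (tsub_pos_of_lt (by exact_mod_cast hr1)).ne'
  filter_upwards [ae_lt_top' (AEMeasurable.tsum fun n ↦ (hm n).const_mul _) hfin] with ω hω
  have h : ∑' n : ℕ, ((r ^ n * ‖f (φ^[n] ω)‖₊ : NNReal) : ENNReal) ≠ ⊤ := by
    simpa [enorm_eq_nnnorm] using hω.ne
  rw [ENNReal.tsum_coe_ne_top_iff_summable, ← NNReal.summable_coe] at h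
  simpa using h

lemma abs_Scoef_le {Ω : Type*} {β : Ω → ℝ} {θ : Ω → Ω} {a : ℝ} (ha : 0 < a) {ω : Ω}
    (h : ∀ i, a ≤ β (θ^[i] ω)) (n : ℕ) : |Scoef β θ ω n| ≤ a⁻¹ ^ (n + 1) := by
  have hb : a ^ (n + 1) ≤ bprod β θ ω (n + 1) := by
    simpa [bprod] using
      Finset.prod_le_prod (s := Finset.range (n + 1)) (fun _ _ ↦ ha.le) fun i _ ↦ h i
  have hp : 0 < a ^ (n + 1) := by positivity
  rw [Scoef, orb, abs_div, Int.abs_fract, abs_of_pos (hp.trans_le hb), inv_pow, ← one_div]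
  exact div_le_div₀ zero_le_one (Int.fract_lt_one _).le hp hb

lemma Tcoef_add_Scoef {Ω : Type*} {β : Ω → ℝ} {θ : Ω → Ω} {ω : Ω} {n : ℕ}
    (h : β (θ^[n] ω) ≠ 0) :
    Tcoef β θ ω n + Scoef β θ ω n = orb β θ ω n / bprod β θ ω n := by
  rw [Tcoef, Scoef, orb, ← add_div, Int.floor_add_fract, bprod, Finset.prod_range_succ, ← bprod,
    mul_comm (bprod β θ ω n), mul_div_mul_left _ _ h]

lemma ae_summable_Scoef_mul {Ω : Type*} [MeasurableSpace Ω] {P : Measure Ω}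
    {θ θinv : Ω → Ω} (hθ : MeasurePreserving θ P P) (hθinv : MeasurePreserving θinv P P)
    {β : Ω → ℝ} (hγ : 1 < essInf β P) {f : Ω → ℝ} (hf : Integrable f P) :
    ∀ᵐ ω ∂P, Summable fun n : ℕ ↦ Scoef β θ (θinv^[n + 1] ω) n * f (θinv^[n + 1] ω) := by
  obtain ⟨a, ha, hβ⟩ := exists_one_lt_ae_le_of_one_lt_essInf hγ
  have ha0 : 0 < a := one_pos.trans ha
  have hall : ∀ᵐ ω ∂P, ∀ n i : ℕ, a ≤ β (θ^[i] (θinv^[n + 1] ω)) :=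
    ae_all_iff.2 fun n ↦ ae_all_iff.2 fun i ↦
      ((hθ.iterate i).comp (hθinv.iterate (n + 1))).quasiMeasurePreserving.ae hβ
  filter_upwards [hall, ae_summable_geometric_mul_iterate hθinv (inv_nonneg.2 ha0.le)
    (inv_lt_one_of_one_lt₀ ha) hf] with ω hω hs
  refine Summable.of_norm_bounded ((summable_nat_add_iff 1).2 hs) fun n ↦ ?_
  rw [Real.norm_eq_abs, abs_mul]
  exact mul_le_mul_of_nonneg_right (abs_Scoef_le ha0 (hω n) n) (abs_nonneg _)

/-- In the invertible setting with `γ := essinf β > 1`, the operator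
identity `I - T = (I - U_{θ⁻¹})(I + S)` holds at the level of functions: for every
`f ∈ L¹(P)` and `P`-a.e. `ω`,
`f ω - (Tf) ω = (f + Sf) ω - (f + Sf) (θ⁻¹ ω)`. -/
theorem stmt_12 {Ω : Type*} [MeasurableSpace Ω] (P : Measure Ω) [IsProbabilityMeasure P]
    (θ θinv : Ω → Ω) (hθ : MeasurePreserving θ P P) (hθinv : MeasurePreserving θinv P P)
    (hli : Function.LeftInverse θinv θ) (hri : Function.RightInverse θinv θ)
    (β : Ω → ℝ) (hβmeas : Measurable β) (hβpos : ∀ ω, 0 < β ω)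
    (hγ : 1 < essInf β P)
    (f : Ω → ℝ) (hf : Integrable f P) :
    ∀ᵐ ω ∂P,
      f ω - TOp β θ θinv f ω
        = (f ω + SOp β θ θinv f ω) - (f (θinv ω) + SOp β θ θinv f (θinv ω)) := by
  have hS := ae_summable_Scoef_mul hθ hθinv hγ hf
  filter_upwards [hS, hθinv.quasiMeasurePreserving.ae hS] with ω h₁ h₂
  set v : ℕ → ℝ := fun n ↦
    orb β θ (θinv^[n + 1] ω) n / bprod β θ (θinv^[n + 1] ω) n * f (θinv^[n + 1] ω) with hv
  have hv_sum : Summable v := (summable_nat_add_iff 1).1 h₂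
  have hv_tsum : ∑' n, v n = f (θinv ω) + SOp β θ θinv f (θinv ω) := by
    rw [hv_sum.tsum_eq_zero_add]
    congr 1
    simp [hv, orb, bprod]
  have hT : TOp β θ θinv f ω = ∑' n, v n - SOp β θ θinv f ω := by
    rw [TOp, SOp, ← hv_sum.tsum_sub h₁]
    refine tsum_congr fun n ↦ ?_
    rw [hv]
    dsimp only
    rw [← Tcoef_add_Scoef (hβpos _).ne']
    ring
  rw [hT, hv_tsum]
  ring
end

section
/- In the invertible setting with γ := essinf β > 1, let c ∈ L^∞(P) satisfy the functional equation c(ω) = ∑_{n=1}^∞ (d_n(θ^{−n}ω, 1)/β^{(n)}_{θ^{−n}ω}) · c(θ^{−n}ω) for P-a.e. ω. Define φ(ω, x) = ∑_{n=0}^∞ (c(θ^{−n}ω)/β^{(n)}_{θ^{−n}ω}) · 𝟙_{[0, τ^n_{θ^{−n}ω}(1)]}(x), which converges absolutely for P-a.e. ω and all x ∈ [0,1]. Then φ satisfies the samplewise Perron–Frobenius equation: for P-a.e. ω ∈ Ω and Lebesgue-a.e. x ∈ [0,1], (1/β(ω)) ∑_{y ∈ [0,1], T_{β(ω)}(y)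 = x} φ(ω, y) = φ(θω, x). -/
open MeasureTheory Filter

/-- The random density `φ(ω, x) = ∑_{n=0}^∞ (c(θ^{-n}ω)/β^{(n)}_{θ^{-n}ω}) 𝟙_{[0, τ^n_{θ^{-n}ω}(1)]}(x)`. -/
noncomputable def phiRand {Ω : Type*} (β : Ω → ℝ) (θ θinv : Ω → Ω) (c : Ω → ℝ)
    (ω : Ω) (x : ℝ) : ℝ :=
  ∑' n : ℕ, c (θinv^[n] ω) / bprod β θ (θinv^[n] ω) n *
    Set.indicator (Set.Icc (0:ℝ) (orb β θ (θinv^[n] ω) n)) (fun _ => (1:ℝ)) x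

lemma orb_mem_Icc {Ω : Type*} (β : Ω → ℝ) (θ : Ω → Ω) (ω : Ω) (n : ℕ) :
    orb β θ ω n ∈ Set.Icc (0 : ℝ) 1 := by
  cases n with
  | zero => simp [orb]
  | succ n => exact ⟨Int.fract_nonneg _, (Int.fract_lt_one _).le⟩

lemma bprod_succ {Ω : Type*} (β : Ω → ℝ) (θ : Ω → Ω) (ω : Ω) (n : ℕ) :
    bprod β θ ω (n + 1) = bprod β θ ω n * β (θ^[n] ω) :=
  Finset.prod_range_succ _ _

/-- Lower bound for the product of `β` along the past of `ω`. -/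
lemma pow_le_bprod_iterate {Ω : Type*} {β : Ω → ℝ} {θ θinv : Ω → Ω}
    (hri : Function.RightInverse θinv θ) {g : ℝ} (hg : 0 ≤ g) (n : ℕ) {ω : Ω}
    (hω : ∀ n, g ≤ β (θinv^[n] ω)) : g ^ n ≤ bprod β θ (θinv^[n] ω) n := by
  induction n generalizing ω with
  | zero => simp [bprod]
  | succ n ih =>
    have h := ih (ω := θinv ω) fun m => by simpa using hω (m + 1)
    rw [bprod_succ, Function.iterate_succ_apply, hri.iterate n, pow_succ]
    exact mul_le_mul h (hω 1) hg ((pow_nonneg hg n).trans h)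

/-- The number of inverse branches of `y ↦ b * y - ⌊b * y⌋` over `x` whose value lies
in `[0, t]`. -/
lemma sum_indicator_branches {b x t : ℝ} (hb : 0 < b) (hx0 : 0 ≤ x) (hx1 : x < 1) (hxb : x ≤ b)
    (ht : t ∈ Set.Icc (0 : ℝ) 1) :
    ∑ k ∈ Finset.range (⌊b - x⌋₊ + 1),
        Set.indicator (Set.Icc (0 : ℝ) t) (fun _ => (1 : ℝ)) ((x + k) / b) =
      ⌊b * t⌋ + Set.indicator (Set.Icc (0 : ℝ) (Int.fract (b * t))) (fun _ => (1 : ℝ)) x := by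
  classical
  have hbt : 0 ≤ b * t := mul_nonneg hb.le ht.1
  have hfl : ((⌊b * t⌋₊ : ℕ) : ℝ) = (⌊b * t⌋ : ℝ) := natCast_floor_eq_intCast_floor hbt
  have hfr : (⌊b * t⌋₊ : ℝ) + Int.fract (b * t) = b * t := by
    rw [hfl]; exact Int.floor_add_fract _
  have hf0 := Int.fract_nonneg (b * t)
  have hf1 := Int.fract_lt_one (b * t)
  have hle : b * t ≤ b := mul_le_of_le_one_right hb.le ht.2
  rw [← hfl]
  generalize ⌊b * t⌋₊ = m at *
  generalize Int.fract (b * t) = f at *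
  have hfilter : (Finset.range (⌊b - x⌋₊ + 1)).filter
      (fun k : ℕ => (x + k) / b ∈ Set.Icc (0 : ℝ) t) =
      Finset.range (m + if x ≤ f then 1 else 0) := by
    ext k
    have hk0 : (0 : ℝ) ≤ k := k.cast_nonneg
    rw [Finset.mem_filter, Finset.mem_range, Finset.mem_range, Nat.lt_succ_iff,
      Nat.le_floor_iff (sub_nonneg.2 hxb), Set.mem_Icc, div_le_iff₀ hb]
    have hnn : 0 ≤ (x + k) / b := by positivity
    split_ifs with h
    · rw [Nat.lt_succ_iff]
      constructor
      · rintro ⟨-, -, h2⟩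
        have : (k : ℝ) < (m + 1 : ℕ) := by push_cast; linarith
        exact Nat.lt_succ_iff.1 (by exact_mod_cast this)
      · intro h2
        have : (k : ℝ) ≤ m := by exact_mod_cast h2
        exact ⟨by linarith, hnn, by linarith⟩
    · rw [not_le] at h
      constructor
      · rintro ⟨-, -, h2⟩
        have : (k : ℝ) < m := by linarith
        exact_mod_cast this
      · intro h2
        have : (k + 1 : ℝ) ≤ m := by exact_mod_cast h2
        exact ⟨by linarith, hnn, by linarith⟩
  simp only [Set.indicator_apply]
  rw [Finset.sum_boole, hfilter, Finset.card_range]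
  simp [Set.mem_Icc, hx0]

/-- The preimages of `x` under the beta-transformation are the values of its inverse branches. -/
lemma finsum_mem_preimages {b x : ℝ} (hb : 0 < b) (hx0 : 0 ≤ x) (hx1 : x < 1) (hxb : x ≤ b)
    (f : ℝ → ℝ) :
    ∑ᶠ y ∈ {y : ℝ | y ∈ Set.Icc (0 : ℝ) 1 ∧ Int.fract (b * y) = x}, f y =
      ∑ k ∈ Finset.range (⌊b - x⌋₊ + 1), f ((x + k) / b) := by
  have hset : {y : ℝ | y ∈ Set.Icc (0 : ℝ) 1 ∧ Int.fract (b * y) = x} =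
      (fun k : ℕ => (x + k) / b) '' (Finset.range (⌊b - x⌋₊ + 1) : Set ℕ) := by
    ext y
    simp only [Set.mem_ofPred_eq, Set.mem_image, Finset.mem_coe, Finset.mem_range,
      Nat.lt_succ_iff, Nat.le_floor_iff (sub_nonneg.2 hxb), Set.mem_Icc]
    constructor
    · rintro ⟨⟨hy0, hy1⟩, hy⟩
      have hby : 0 ≤ b * y := mul_nonneg hb.le hy0
      have hfl : ((⌊b * y⌋₊ : ℕ) : ℝ) = (⌊b * y⌋ : ℝ) := natCast_floor_eq_intCast_floor hby
      have hsum := Int.floor_add_fract (b * y)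
      rw [← hfl, hy] at hsum
      refine ⟨⌊b * y⌋₊, ?_, ?_⟩
      · have := mul_le_of_le_one_right hb.le hy1
        linarith
      · rw [div_eq_iff hb.ne']
        linarith
    · rintro ⟨k, hk, rfl⟩
      refine ⟨⟨by positivity, by rw [div_le_one hb]; linarith⟩, ?_⟩
      rw [mul_div_cancel₀ _ hb.ne', Int.fract_add_natCast, Int.fract_eq_self]
      exact ⟨hx0, hx1⟩
  have hinj : Set.InjOn (fun k : ℕ => (x + k) / b) (Finset.range (⌊b - x⌋₊ + 1) : Set ℕ) := by
    intro k _ l _ hkl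
    simpa [div_left_inj' hb.ne'] using hkl
  rw [hset, finsum_mem_image hinj, finsum_mem_coe_finset]

lemma summable_mul_indicator {a : ℕ → ℝ} (ha : Summable fun n => |a n|) (s : ℕ → Set ℝ) (x : ℝ) :
    Summable fun n => |a n * Set.indicator (s n) (fun _ => (1 : ℝ)) x| := by
  refine ha.of_nonneg_of_le (fun _ => abs_nonneg _) fun n => ?_
  by_cases h : x ∈ s n <;> simp [h]

/-- The Perron–Frobenius equation along a single fibre. -/
lemma perronFrobenius_fibre {Ω : Type*} {β : Ω → ℝ} {θ θinv : Ω → Ω}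
    (hli : Function.LeftInverse θinv θ) (hri : Function.RightInverse θinv θ) {c : Ω → ℝ} {ω : Ω}
    (hβ : 0 < β ω)
    (hsum : Summable fun n => |c (θinv^[n] ω) / bprod β θ (θinv^[n] ω) n|)
    (hfe : c (θ ω) = ∑' n : ℕ, Tcoef β θ (θinv^[n + 1] (θ ω)) n * c (θinv^[n + 1] (θ ω)))
    {x : ℝ} (hx0 : 0 ≤ x) (hx1 : x < 1) (hxβ : x ≤ β ω) :
    (β ω)⁻¹ * ∑ᶠ y ∈ {y : ℝ | y ∈ Set.Icc (0:ℝ) 1 ∧ Int.fract (β ω * y) = x},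
        phiRand β θ θinv c ω y
      = phiRand β θ θinv c (θ ω) x := by
  have hback : ∀ n, θinv^[n + 1] (θ ω) = θinv^[n] ω := fun n => by
    rw [Function.iterate_succ_apply, hli]
  have horb : ∀ n, orb β θ (θinv^[n] ω) (n + 1) =
      Int.fract (β ω * orb β θ (θinv^[n] ω) n) := fun n => by
    rw [orb, hri.iterate n]
  have hbprod : ∀ n, bprod β θ (θinv^[n] ω) (n + 1) = bprod β θ (θinv^[n] ω) n * β ω :=
    fun n => by rw [bprod_succ, hri.iterate n]
  set a : ℕ → ℝ := fun n => c (θinv^[n] ω) / bprod β θ (θinv^[n] ω) n with ha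
  set t : ℕ → ℝ := fun n => orb β θ (θinv^[n] ω) n with ht
  have hind : ∀ (s : ℕ → Set ℝ) (y : ℝ),
      Summable fun n => a n * Set.indicator (s n) (fun _ => (1 : ℝ)) y :=
    fun s y => (summable_mul_indicator hsum s y).of_abs
  have hfloor : Summable fun n => a n * (⌊β ω * t n⌋ : ℝ) := by
    refine Summable.of_norm_bounded (hsum.mul_right (β ω)) fun n => ?_
    have htn : t n ∈ Set.Icc (0 : ℝ) 1 := orb_mem_Icc β θ _ n
    have h0 : (0 : ℝ) ≤ ⌊β ω * t n⌋ := by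
      exact_mod_cast Int.floor_nonneg.2 (mul_nonneg hβ.le htn.1)
    rw [norm_mul, Real.norm_eq_abs, Real.norm_eq_abs, abs_of_nonneg h0]
    exact mul_le_mul_of_nonneg_left
      ((Int.floor_le _).trans (mul_le_of_le_one_right hβ.le htn.2)) (abs_nonneg _)
  have hbranches : ∑ k ∈ Finset.range (⌊β ω - x⌋₊ + 1), phiRand β θ θinv c ω ((x + k) / β ω) =
      ∑' n, a n * (⌊β ω * t n⌋ : ℝ) + ∑' n, a n *
        Set.indicator (Set.Icc (0 : ℝ) (Int.fract (β ω * t n))) (fun _ => (1 : ℝ)) x := by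
    unfold phiRand
    rw [← Summable.tsum_finsetSum fun k _ => hind _ _, ← hfloor.tsum_add (hind _ _)]
    refine tsum_congr fun n => ?_
    rw [← Finset.mul_sum, ← mul_add,
      sum_indicator_branches hβ hx0 hx1 hxβ (orb_mem_Icc β θ _ n)]
  have hc : c (θ ω) = (β ω)⁻¹ * ∑' n, a n * (⌊β ω * t n⌋ : ℝ) := by
    rw [hfe, ← tsum_mul_left]
    refine tsum_congr fun n => ?_
    rw [hback, Tcoef, hbprod, hri.iterate n]
    simp only [ha, ht, div_eq_mul_inv, mul_inv]
    ring
  have hterm : ∀ n, c (θinv^[n + 1] (θ ω)) / bprod β θ (θinv^[n + 1] (θ ω)) (n + 1) *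
      Set.indicator (Set.Icc (0 : ℝ) (orb β θ (θinv^[n + 1] (θ ω)) (n + 1)))
        (fun _ => (1 : ℝ)) x =
      (β ω)⁻¹ * (a n *
        Set.indicator (Set.Icc (0 : ℝ) (Int.fract (β ω * t n))) (fun _ => (1 : ℝ)) x) := by
    intro n
    rw [hback, horb, hbprod]
    simp only [ha, ht, div_eq_mul_inv, mul_inv]
    ring
  have hphi : Summable fun n => c (θinv^[n] (θ ω)) / bprod β θ (θinv^[n] (θ ω)) n *
      Set.indicator (Set.Icc (0 : ℝ) (orb β θ (θinv^[n] (θ ω)) n)) (fun _ => (1 : ℝ)) x :=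
    (summable_nat_add_iff 1).1 ((summable_congr hterm).2 ((hind _ _).mul_left _))
  rw [finsum_mem_preimages hβ hx0 hx1 hxβ, hbranches, phiRand, hphi.tsum_eq_zero_add,
    tsum_congr hterm, tsum_mul_left, mul_add, ← hc]
  simp [bprod, orb, hx0, hx1.le]

/-- In the invertible setting with `γ := essinf β > 1`, if `c ∈ L^∞(P)`
satisfies the functional equation
`c(ω) = ∑_{n=1}^∞ (d_n(θ^{-n}ω,1)/β^{(n)}_{θ^{-n}ω}) c(θ^{-n}ω)` a.e., then the series
defining `φ(ω, x)` converges absolutely for a.e. `ω` and all `x ∈ [0,1]`, and `φ` satisfies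
the samplewise Perron–Frobenius equation: for a.e. `ω` and Lebesgue-a.e. `x ∈ [0,1]`,
`(1/β(ω)) ∑_{y ∈ [0,1], T_{β(ω)} y = x} φ(ω, y) = φ(θω, x)`. -/
theorem stmt_14 {Ω : Type*} [MeasurableSpace Ω] (P : Measure Ω) [IsProbabilityMeasure P]
    (θ θinv : Ω → Ω) (hθ : MeasurePreserving θ P P) (hθinv : MeasurePreserving θinv P P)
    (hli : Function.LeftInverse θinv θ) (hri : Function.RightInverse θinv θ)
    (β : Ω → ℝ) (hβmeas : Measurable β) (hβpos : ∀ ω, 0 < β ω)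
    (hγ : 1 < essInf β P)
    (c : Ω → ℝ) (hcmeas : Measurable c) (C : ℝ) (hC : ∀ᵐ ω ∂P, |c ω| ≤ C)
    (hfe : ∀ᵐ ω ∂P, c ω = ∑' n : ℕ, Tcoef β θ (θinv^[n + 1] ω) n * c (θinv^[n + 1] ω)) :
    (∀ᵐ ω ∂P, ∀ x ∈ Set.Icc (0:ℝ) 1,
      Summable fun n : ℕ => |c (θinv^[n] ω) / bprod β θ (θinv^[n] ω) n *
        Set.indicator (Set.Icc (0:ℝ) (orb β θ (θinv^[n] ω) n)) (fun _ => (1:ℝ)) x|) ∧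
    (∀ᵐ ω ∂P, ∀ᵐ x ∂(volume.restrict (Set.Icc (0:ℝ) 1)),
      (β ω)⁻¹ * ∑ᶠ y ∈ {y : ℝ | y ∈ Set.Icc (0:ℝ) 1 ∧ Int.fract (β ω * y) = x},
          phiRand β θ θinv c ω y
        = phiRand β θ θinv c (θ ω) x) := by
  obtain ⟨g, hg, hg1⟩ : ∃ g : ℝ, (∀ᵐ ω ∂P, g ≤ β ω) ∧ 1 < g := by
    rw [essInf, liminf_eq] at hγ
    exact exists_lt_of_lt_csSup
      ⟨0, Eventually.of_forall fun ω => (hβpos ω).le⟩ hγ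
  have hpast : ∀ {p : Ω → Prop}, (∀ᵐ ω ∂P, p ω) → ∀ᵐ ω ∂P, ∀ n, p (θinv^[n] ω) :=
    fun h => ae_all_iff.2 fun n => (hθinv.iterate n).quasiMeasurePreserving.ae h
  have hsum : ∀ᵐ ω ∂P, Summable fun n => |c (θinv^[n] ω) / bprod β θ (θinv^[n] ω) n| := by
    filter_upwards [hpast hg, hpast hC] with ω hgω hCω
    have hg0 : 0 < g := one_pos.trans hg1
    refine ((summable_geometric_of_lt_one (inv_nonneg.2 hg0.le) (inv_lt_one_of_one_lt₀ hg1)).mul_left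
      C).of_nonneg_of_le (fun _ => abs_nonneg _) fun n => ?_
    have hb := pow_le_bprod_iterate hri hg0.le n hgω
    have hgn : 0 < g ^ n := pow_pos hg0 n
    rw [abs_div, abs_of_pos (hgn.trans_le hb), inv_pow, ← div_eq_mul_inv]
    exact div_le_div₀ ((abs_nonneg _).trans (hCω n)) (hCω n) hgn hb
  refine ⟨?_, ?_⟩
  · filter_upwards [hsum] with ω hω x _
    exact summable_mul_indicator hω _ x
  · filter_upwards [hsum, hg, hθ.quasiMeasurePreserving.ae hfe] with ω hω hgω hfeω
    filter_upwards [ae_restrict_mem measurableSet_Icc,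
      ae_restrict_of_ae (Measure.ae_ne volume (1 : ℝ))] with x hx hx1
    exact perronFrobenius_fibre hli hri (hβpos ω) hω hfeω hx.1 (lt_of_le_of_ne hx.2 hx1)
      (hx.2.trans (hg1.le.trans hgω))
end
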